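/- The linear operator field L(x,y,z) = [[2x−z,−y,z−x],[y,z,0],[0,0,z]] on ℝ³ is a Nijenhuis operator; the coefficients of its characteristic polynomial are σ₁ = −2x−z, σ₂ = y²+4xz−z², σ₃ = −y²z−2xz²+z³, and these three polynomials are algebraically independent over ℝ. Consequently the algebra with relations η₁⋆η₁ = 2η₁, η₁⋆η₂ = η₂, η₁⋆η₃ = −η₁, η₂⋆η₂ = −η₁, η₂⋆η₃ = η₂, η₃⋆η₁ = −η₁, η₃⋆η₃ = η₁+η₃ (other products zero) is a differentially non-degenerate LSA. -/

import Mathlib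

open Matrix

/-- Components `N^i_{jk}` of the Nijenhuis torsion of a matrix-valued operator
field `L` on `ℝⁿ` (with `L x i j = L^i_j(x)`). -/
noncomputable def nijTorsion {n : ℕ} (L : (Fin n → ℝ) → Matrix (Fin n) (Fin n) ℝ)
    (x : Fin n → ℝ) (i j k : Fin n) : ℝ :=
  ∑ s : Fin n,
    (L x s j * fderiv ℝ (fun y => L y i k) x (Pi.single s 1)
      - L x s k * fderiv ℝ (fun y => L y i j) x (Pi.single s 1)
      - L x i s * fderiv ℝ (fun y => L y s k) x (Pi.single j 1)
      + L x i s * fderiv ℝ (fun y => L y s j) x (Pi.single k 1))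

/-- `L` is a Nijenhuis operator: its Nijenhuis torsion vanishes identically. -/
def IsNijenhuis {n : ℕ} (L : (Fin n → ℝ) → Matrix (Fin n) (Fin n) ℝ) : Prop :=
  ∀ x i j k, nijTorsion L x i j k = 0

/-- Bilinear product on `ℝⁿ` with structure constants `a i j k`
(`ηᵢ ⋆ ηⱼ = ∑ₖ a i j k • ηₖ`). -/
def mulSC {n : ℕ} (a : Fin n → Fin n → Fin n → ℝ) (ξ η : Fin n → ℝ) : Fin n → ℝ :=
  fun k => ∑ i : Fin n, ∑ j : Fin n, a i j k * ξ i * η j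

/-- Left-symmetry: the associator is symmetric in its first two arguments. -/
def IsLSA {n : ℕ} (a : Fin n → Fin n → Fin n → ℝ) : Prop :=
  ∀ ξ η ζ : Fin n → ℝ,
    mulSC a (mulSC a ξ η) ζ - mulSC a ξ (mulSC a η ζ)
      = mulSC a (mulSC a η ξ) ζ - mulSC a η (mulSC a ξ ζ)

/-- The right-adjoint operator field of the algebra with structure constants `a`:
`(R x) k i = ∑ j, a i j k * x j`, i.e. `(R x).mulVec ξ = ξ ⋆ x`. -/
def rightAdj {n : ℕ} (a : Fin n → Fin n → Fin n → ℝ) (x : Fin n → ℝ) :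
    Matrix (Fin n) (Fin n) ℝ :=
  Matrix.of fun k i => ∑ j : Fin n, a i j k * x j

/-- `charCoeff L i` is the coefficient `σ_{i+1}` of `t^(n-1-i)` in the characteristic
polynomial `χ_{L(x)}(t) = tⁿ + σ₁(x) tⁿ⁻¹ + ⋯ + σₙ(x)` of `L(x)`. -/
noncomputable def charCoeff {n : ℕ} (L : (Fin n → ℝ) → Matrix (Fin n) (Fin n) ℝ)
    (i : Fin n) : (Fin n → ℝ) → ℝ :=
  fun x => (L x).charpoly.coeff (n - 1 - (i : ℕ))

/-- A (structure-constant) algebra is differentially non-degenerate if the coefficients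
of the characteristic polynomial of its right-adjoint operator are algebraically
independent over `ℝ` (as elements of the algebra of real-valued functions). -/
def DiffNonDeg {n : ℕ} (a : Fin n → Fin n → Fin n → ℝ) : Prop :=
  AlgebraicIndependent ℝ (charCoeff (rightAdj a))

/-- Isomorphism of the algebras on `ℝⁿ` with structure constants `a` and `b`. -/
def AlgIsoSC {n : ℕ} (a b : Fin n → Fin n → Fin n → ℝ) : Prop :=
  ∃ φ : (Fin n → ℝ) ≃ₗ[ℝ] (Fin n → ℝ),
    ∀ ξ η : Fin n → ℝ, φ (mulSC a ξ η) = mulSC b (φ ξ) (φ η)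

/-- Jacobi matrix of a family of functions `σ` on `ℝⁿ`: `J i j = ∂σᵢ/∂xⱼ`. -/
noncomputable def jacobiMat {n : ℕ} (σ : Fin n → (Fin n → ℝ) → ℝ) (x : Fin n → ℝ) :
    Matrix (Fin n) (Fin n) ℝ :=
  Matrix.of fun i j => fderiv ℝ (σ i) x (Pi.single j 1)

/-- Companion-type matrix with first column `(-s 0, …, -s (n-1))ᵀ`, ones on the
superdiagonal and zeros elsewhere. -/
def companionS {n : ℕ} (s : Fin n → ℝ) : Matrix (Fin n) (Fin n) ℝ :=
  Matrix.of fun i j => if (j : ℕ) = 0 then -s i else if (j : ℕ) = (i : ℕ) + 1 then 1 else 0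

/-- The operator field of the first indecomposable algebra. -/
def Lop (x : Fin 3 → ℝ) : Matrix (Fin 3) (Fin 3) ℝ :=
  Matrix.of ![![2 * x 0 - x 2, -x 1, x 2 - x 0], ![x 1, x 2, 0], ![0, 0, x 2]]

/-- Structure constants of the first indecomposable algebra. -/
def sc : Fin 3 → Fin 3 → Fin 3 → ℝ :=
  ![![![2,0,0], ![0,1,0], ![-1,0,0]],
    ![![0,0,0], ![-1,0,0], ![0,1,0]],
    ![![-1,0,0], ![0,0,0], ![1,0,1]]]

/-- If `s₁, s₂ ≥ 0 ≥ s₃`, the cubic `t³ + s₁ t² + s₂ t + s₃` has a nonnegative real root. -/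
lemma exists_nonneg_root_cubic {s₁ s₂ s₃ : ℝ} (h₁ : 0 ≤ s₁) (h₂ : 0 ≤ s₂) (h₃ : s₃ ≤ 0) :
    ∃ t : ℝ, 0 ≤ t ∧ t ^ 3 + s₁ * t ^ 2 + s₂ * t + s₃ = 0 := by
  have hc : ContinuousOn (fun t : ℝ => t ^ 3 + s₁ * t ^ 2 + s₂ * t + s₃) (Set.Icc 0 (1 - s₃)) := by
    fun_prop
  have hT : 1 ≤ 1 - s₃ := by linarith
  have hcube : 1 - s₃ ≤ (1 - s₃) ^ 3 := le_self_pow₀ hT (by norm_num)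
  have hsq : 0 ≤ s₁ * (1 - s₃) ^ 2 := by positivity
  have hlin : 0 ≤ s₂ * (1 - s₃) := mul_nonneg h₂ (by linarith)
  obtain ⟨t, ht, hroot⟩ := intermediate_value_Icc (by linarith) hc
    (show (0 : ℝ) ∈ Set.Icc _ _ from ⟨by simpa using h₃, by linarith⟩)
  exact ⟨t, ht.1, hroot⟩

/-- The coefficients of the characteristic polynomial of `Lop` take every value in the octant
`s₁, s₂ ≥ 0 ≥ s₃`. -/
lemma exists_charCoeff_values {s₁ s₂ s₃ : ℝ} (h₁ : 0 ≤ s₁) (h₂ : 0 ≤ s₂) (h₃ : s₃ ≤ 0) :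
    ∃ x : Fin 3 → ℝ, -2 * x 0 - x 2 = s₁ ∧ x 1 ^ 2 + 4 * x 0 * x 2 - x 2 ^ 2 = s₂ ∧
      -(x 1 ^ 2 * x 2) - 2 * x 0 * x 2 ^ 2 + x 2 ^ 3 = s₃ := by
  obtain ⟨t, ht, hroot⟩ := exists_nonneg_root_cubic h₁ h₂ h₃
  have hsq : √(3 * t ^ 2 + 2 * s₁ * t + s₂) ^ 2 = 3 * t ^ 2 + 2 * s₁ * t + s₂ :=
    Real.sq_sqrt (by positivity)
  refine ⟨![-(s₁ + t) / 2, √(3 * t ^ 2 + 2 * s₁ * t + s₂), t], ?_, ?_, ?_⟩ <;>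
    simp only [cons_val] <;> try rw [hsq]
  · ring
  · ring
  · linear_combination -hroot

lemma algebraicIndependent_charCoeff_values :
    AlgebraicIndependent ℝ
      ![(fun x : Fin 3 → ℝ => -2 * x 0 - x 2),
        (fun x : Fin 3 → ℝ => x 1 ^ 2 + 4 * x 0 * x 2 - x 2 ^ 2),
        (fun x : Fin 3 → ℝ => -(x 1 ^ 2 * x 2) - 2 * x 0 * x 2 ^ 2 + x 2 ^ 3)] := by
  rw [algebraicIndependent_iff]
  intro p hp
  refine MvPolynomial.funext_set ![Set.Ici 0, Set.Ici 0, Set.Iic 0] ?_ ?_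
  · intro i
    fin_cases i
    exacts [Set.Ici_infinite 0, Set.Ici_infinite 0, Set.Iic_infinite 0]
  · intro s hs
    obtain ⟨x, hx₁, hx₂, hx₃⟩ := exists_charCoeff_values
      (hs 0 (Set.mem_univ _)) (hs 1 (Set.mem_univ _)) (hs 2 (Set.mem_univ _))
    have h := congrArg (Pi.evalAlgHom ℝ (fun _ : Fin 3 → ℝ => ℝ) x) hp
    rw [← AlgHom.comp_apply, MvPolynomial.comp_aeval, MvPolynomial.aeval_eq_eval] at h
    rw [map_zero] at h ⊢
    rw [← h]
    congr 2
    funext i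
    fin_cases i
    exacts [hx₁.symm, hx₂.symm, hx₃.symm]

lemma coeff_monic_cubic {R : Type*} [CommRing R] (a b c : R) :
    let p : Polynomial R := Polynomial.X ^ 3 + Polynomial.C a * Polynomial.X ^ 2 +
      Polynomial.C b * Polynomial.X + Polynomial.C c
    p.coeff 2 = a ∧ p.coeff 1 = b ∧ p.coeff 0 = c := by
  simp [Polynomial.coeff_X, Polynomial.coeff_X_pow, Polynomial.coeff_C]

lemma charpoly_Lop (x : Fin 3 → ℝ) :
    (Lop x).charpoly = Polynomial.X ^ 3 + Polynomial.C (-2 * x 0 - x 2) * Polynomial.X ^ 2 +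
      Polynomial.C (x 1 ^ 2 + 4 * x 0 * x 2 - x 2 ^ 2) * Polynomial.X +
      Polynomial.C (-(x 1 ^ 2 * x 2) - 2 * x 0 * x 2 ^ 2 + x 2 ^ 3) := by
  rw [Matrix.charpoly, Matrix.det_fin_three]
  simp only [Lop, charmatrix_apply, diagonal_apply, of_apply, cons_val', cons_val, map_add,
    map_sub, map_mul, map_neg, map_pow, map_ofNat, Fin.reduceEq, if_true, if_false, map_zero]
  ring

lemma isNijenhuis_Lop : IsNijenhuis Lop := by
  intro x i j k
  have hcoord (l : Fin 3) (v : Fin 3 → ℝ) : fderiv ℝ (fun y : Fin 3 → ℝ => y l) x v = v l := by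
    rw [(hasFDerivAt_apply l x).fderiv]; rfl
  have h00 (v : Fin 3 → ℝ) : fderiv ℝ (fun y : Fin 3 → ℝ => 2 * y 0 - y 2) x v
      = 2 * v 0 - v 2 := by
    rw [(((hasFDerivAt_apply (𝕜 := ℝ) 0 x).const_mul (2 : ℝ)).fun_sub
      (hasFDerivAt_apply 2 x)).fderiv]; rfl
  have h02 (v : Fin 3 → ℝ) : fderiv ℝ (fun y : Fin 3 → ℝ => y 2 - y 0) x v = v 2 - v 0 := by
    rw [((hasFDerivAt_apply (𝕜 := ℝ) 2 x).fun_sub (hasFDerivAt_apply 0 x)).fderiv]; rfl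
  fin_cases i <;> fin_cases j <;> fin_cases k <;>
    simp [nijTorsion, Fin.sum_univ_three, Lop, hcoord, h00, h02] <;> ring

lemma rightAdj_sc : rightAdj sc = Lop := by
  funext x
  ext k i
  fin_cases k <;> fin_cases i <;> simp [rightAdj, sc, Lop, Fin.sum_univ_three] <;> ring

lemma isLSA_sc : IsLSA sc := by
  intro ξ η ζ
  funext k
  fin_cases k <;> simp [mulSC, sc, Fin.sum_univ_three] <;> ring

/-- The operator field is a Nijenhuis operator; the coefficients of its
characteristic polynomial are the stated polynomials, which are algebraically
independent over `ℝ`; it is the right-adjoint operator of the stated algebra,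
which is consequently a differentially non-degenerate LSA. -/
theorem stmt12 :
    IsNijenhuis Lop ∧
    (∀ x : Fin 3 → ℝ, charCoeff Lop 0 x = -2 * x 0 - x 2) ∧
    (∀ x : Fin 3 → ℝ, charCoeff Lop 1 x = x 1 ^ 2 + 4 * x 0 * x 2 - x 2 ^ 2) ∧
    (∀ x : Fin 3 → ℝ, charCoeff Lop 2 x = -(x 1 ^ 2 * x 2) - 2 * x 0 * x 2 ^ 2 + x 2 ^ 3) ∧
    AlgebraicIndependent ℝ
      ![(fun x : Fin 3 → ℝ => -2 * x 0 - x 2),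
        (fun x : Fin 3 → ℝ => x 1 ^ 2 + 4 * x 0 * x 2 - x 2 ^ 2),
        (fun x : Fin 3 → ℝ => -(x 1 ^ 2 * x 2) - 2 * x 0 * x 2 ^ 2 + x 2 ^ 3)] ∧
    rightAdj sc = Lop ∧ IsLSA sc ∧ DiffNonDeg sc := by
  have h₁ (x : Fin 3 → ℝ) : charCoeff Lop 0 x = -2 * x 0 - x 2 := by
    rw [charCoeff, charpoly_Lop]
    exact (coeff_monic_cubic _ _ _).1
  have h₂ (x : Fin 3 → ℝ) : charCoeff Lop 1 x = x 1 ^ 2 + 4 * x 0 * x 2 - x 2 ^ 2 := by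
    rw [charCoeff, charpoly_Lop]
    exact (coeff_monic_cubic _ _ _).2.1
  have h₃ (x : Fin 3 → ℝ) :
      charCoeff Lop 2 x = -(x 1 ^ 2 * x 2) - 2 * x 0 * x 2 ^ 2 + x 2 ^ 3 := by
    rw [charCoeff, charpoly_Lop]
    exact (coeff_monic_cubic _ _ _).2.2
  refine ⟨isNijenhuis_Lop, h₁, h₂, h₃, algebraicIndependent_charCoeff_values, rightAdj_sc,
    isLSA_sc, ?_⟩
  rw [DiffNonDeg, rightAdj_sc]
  convert algebraicIndependent_charCoeff_values using 1
  funext i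
  fin_cases i
  exacts [funext h₁, funext h₂, funext h₃]
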